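/- arXiv:2107.11408 — 6 statements merged into one kernel-verified Lean document; each statement's English description precedes it below -/
import Mathlib

section
/- Let S be a real N×N skew-symmetric matrix, b_1, …, b_s ∈ ℝ, Δt ∈ ℝ, y, Y_1, …, Y_s ∈ ℝ^N, d := Δt Σ_{i=1}^s b_i S Y_i with d ≠ 0, γ := −2⟨y, d⟩/‖d‖², and y₊ := y + γ d. Then the directional derivative of the relaxation parameter along the solution vanishes: ⟨−(2/‖d‖²) d, y⟩ + Σ_{i=1}^s ⟨−(2 b_i Δt/‖d‖²) Sᵀ y₊, Y_i⟩ = 0; equivalently, ⟨∇_y γ, y⟩ = γ and Σ_i ⟨∇_{Y_i} γ, Y_i⟩ = −γ, so that ρ := ⟨∇_y γ, y⟩ + Σ_i ⟨∇_{Y_i} γ, Y_i⟩ = 0. -/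
open scoped RealInnerProductSpace BigOperators
open Matrix

/-- The Euclidean adjoint of a real matrix is its transpose. -/
theorem inner_toEuclideanLin_transpose {m n : Type*} [Fintype m] [DecidableEq m] [Fintype n]
    [DecidableEq n] (A : Matrix m n ℝ) (x : EuclideanSpace ℝ m) (z : EuclideanSpace ℝ n) :
    ⟪Matrix.toEuclideanLin Aᵀ x, z⟫ = ⟪x, Matrix.toEuclideanLin A z⟫ := by
  rw [← Matrix.conjTranspose_eq_transpose_of_trivial,
    Matrix.toEuclideanLin_conjTranspose_eq_adjoint, LinearMap.adjoint_inner_left]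

/-- For skew-symmetric `S`, with search direction `d = Δt ∑ᵢ bᵢ S Yᵢ ≠ 0`,
relaxation parameter `γ = −2⟨y,d⟩/‖d‖²` and relaxed update `y₊ = y + γ d`, the
directional derivative of the relaxation parameter along the solution vanishes:
`⟨∇_y γ, y⟩ = γ`, `∑ᵢ ⟨∇_{Yᵢ} γ, Yᵢ⟩ = −γ`, and so
`ρ = ⟨∇_y γ, y⟩ + ∑ᵢ ⟨∇_{Yᵢ} γ, Yᵢ⟩ = 0`. -/
theorem rrk_rho_vanishes_skew (N s : ℕ)
    (S : Matrix (Fin N) (Fin N) ℝ) (hS : Sᵀ = -S)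
    (b : Fin s → ℝ) (Δt : ℝ)
    (y : EuclideanSpace ℝ (Fin N)) (Y : Fin s → EuclideanSpace ℝ (Fin N))
    (d : EuclideanSpace ℝ (Fin N))
    (hd : d = Δt • ∑ i, b i • Matrix.toEuclideanLin S (Y i))
    (hdne : d ≠ 0)
    (γ : ℝ) (hγ : γ = -2 * ⟪y, d⟫ / ‖d‖ ^ 2)
    (yplus : EuclideanSpace ℝ (Fin N)) (hyplus : yplus = y + γ • d) :
    ⟪(-(2 / ‖d‖ ^ 2)) • d, y⟫ = γ ∧
    (∑ i, ⟪(-(2 * b i * Δt / ‖d‖ ^ 2)) • Matrix.toEuclideanLin Sᵀ yplus, Y i⟫) = -γ ∧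
    ⟪(-(2 / ‖d‖ ^ 2)) • d, y⟫
      + ∑ i, ⟪(-(2 * b i * Δt / ‖d‖ ^ 2)) • Matrix.toEuclideanLin Sᵀ yplus, Y i⟫ = 0 := by
  have hnorm : ‖d‖ ^ 2 ≠ 0 := pow_ne_zero 2 (norm_ne_zero_iff.mpr hdne)
  have hy : ⟪(-(2 / ‖d‖ ^ 2)) • d, y⟫ = γ := by
    rw [real_inner_smul_left, real_inner_comm, hγ]
    ring
  have hsum : ∑ i, ⟪(-(2 * b i * Δt / ‖d‖ ^ 2)) • Matrix.toEuclideanLin Sᵀ yplus, Y i⟫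
      = -(2 / ‖d‖ ^ 2) * ⟪yplus, d⟫ := by
    have hinner : ⟪yplus, d⟫ = Δt * ∑ i, b i * ⟪yplus, Matrix.toEuclideanLin S (Y i)⟫ := by
      rw [hd, real_inner_smul_right, inner_sum]
      simp only [real_inner_smul_right]
    rw [hinner, Finset.mul_sum, Finset.mul_sum]
    refine Finset.sum_congr rfl fun i _ => ?_
    rw [real_inner_smul_left, inner_toEuclideanLin_transpose]
    ring
  have hY : ∑ i, ⟪(-(2 * b i * Δt / ‖d‖ ^ 2)) • Matrix.toEuclideanLin Sᵀ yplus, Y i⟫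
      = -γ := by
    rw [hsum, hyplus, inner_add_left, real_inner_smul_left, real_inner_self_eq_norm_sq, hγ]
    field_simp
    ring
  exact ⟨hy, hY, by rw [hy, hY, add_neg_cancel]⟩
end

section
/- (IDT equals linearized IDT on skew-symmetric linear systems.) Let S be a real N×N skew-symmetric matrix, let (a_{ij}) with a_{ij} = 0 for j ≥ i and b_1, …, b_s be the coefficients of an s-stage explicit Runge–Kutta method, let Δt > 0, y_init ∈ ℝ^N, and K ≥ 1. Define the IDT sequences: y_0 = y_init, and for k = 1, …, K: Y_{k,i} = y_{k−1} + Δt Σ_{j<i} a_{ij} S Y_{k,j} (i = 1, …, s), d_k = Δt Σ_{i} b_i S Y_{k,i}, assume d_k ≠ 0, γ_k = −2⟨y_{k−1}, d_k⟩/‖d_k‖², y_k = y_{k−1} + γ_k d_k. Define the linearized IDT sequences with zero sources: δ_0 = y_init, and for k = 1, …, K: Δ_{k,i} = δ_{k−1} + Δt Σ_{j<i} a_{ij} S Δ_{k,j}, ρ_k = ⟨−(2/‖d_k‖²) d_k, δ_{k−1}⟩ + Σ_i ⟨−(2 b_i Δt/‖d_k‖²) Sᵀ y_k, Δ_{k,i}⟩,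 δ_k = δ_{k−1} + γ_k Δt Σ_i b_i S Δ_{k,i} + ρ_k d_k. Then δ_k = y_k and Δ_{k,i} = Y_{k,i} for all k = 0, …, K and i = 1, …, s. -/
open scoped RealInnerProductSpace BigOperators
open Matrix

/-- The stage equations of an explicit Runge–Kutta method determine the stages. -/
lemma explicit_stages_unique {E : Type*} [AddCommGroup E] [Module ℝ E] {s : ℕ}
    (f : E → E) {a : Fin s → Fin s → ℝ} (ha : ∀ i j : Fin s, i ≤ j → a i j = 0)
    (h : ℝ) (x : E) {Y Z : Fin s → E}
    (hY : ∀ i, Y i = x + h • ∑ j, a i j • f (Y j))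
    (hZ : ∀ i, Z i = x + h • ∑ j, a i j • f (Z j)) (i : Fin s) : Z i = Y i := by
  induction i using WellFoundedLT.induction with
  | ind i ih =>
    rw [hY i, hZ i]
    congr 2
    refine Finset.sum_congr rfl fun j _ => ?_
    rcases lt_or_ge j i with hj | hj
    · rw [ih j hj]
    · simp [ha i j hj]

lemma inner_toEuclideanLin_transpose_left {m n : Type*} [Fintype m] [Fintype n]
    [DecidableEq m] [DecidableEq n] (S : Matrix m n ℝ)
    (u : EuclideanSpace ℝ m) (v : EuclideanSpace ℝ n) :
    ⟪Matrix.toEuclideanLin Sᵀ u, v⟫ = ⟪u, Matrix.toEuclideanLin S v⟫ := by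
  rw [← conjTranspose_eq_transpose_of_trivial, toEuclideanLin_conjTranspose_eq_adjoint,
    LinearMap.adjoint_inner_left]

/-- The relaxation parameter makes the search direction orthogonal to the sum of the
old and the new iterate. -/
lemma inner_add_inner_relaxed_eq_zero {E : Type*} [NormedAddCommGroup E]
    [InnerProductSpace ℝ E] {x d : E} (hd : d ≠ 0) :
    ⟪d, x⟫ + ⟪x + (-2 * ⟪x, d⟫ / ‖d‖ ^ 2) • d, d⟫ = 0 := by
  have hn : ‖d‖ ≠ 0 := norm_ne_zero_iff.mpr hd
  rw [inner_add_left, real_inner_smul_left, real_inner_self_eq_norm_sq, real_inner_comm x d]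
  field_simp
  ring

/-- (IDT equals linearized IDT on skew-symmetric linear systems.)
For a skew-symmetric matrix `S`, an explicit Runge–Kutta method `(a, b)` (so
`a i j = 0` for `j ≥ i`), and `Δt > 0`, if the IDT sequences `y, Y, d, γ` (with
`d k ≠ 0`) and the linearized IDT sequences `δ, Δ, ρ` (with zero sources and initial
datum `δ₀ = y_init`) satisfy their defining recursions for `k = 1, …, K`, then
`δ k = y k` for `k = 0, …, K` and `Δ k i = Y k i` for all steps `k = 1, …, K` and
stages `i`. -/
theorem idt_equals_linearized_idt_skew (N s K : ℕ) (hK : 1 ≤ K)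
    (S : Matrix (Fin N) (Fin N) ℝ) (hS : Sᵀ = -S)
    (a : Fin s → Fin s → ℝ) (ha : ∀ i j : Fin s, i ≤ j → a i j = 0)
    (b : Fin s → ℝ) (Δt : ℝ) (hΔt : 0 < Δt)
    (yinit : EuclideanSpace ℝ (Fin N))
    (y δ : ℕ → EuclideanSpace ℝ (Fin N))
    (Y Δ : ℕ → Fin s → EuclideanSpace ℝ (Fin N))
    (d : ℕ → EuclideanSpace ℝ (Fin N)) (γ ρ : ℕ → ℝ)
    -- IDT (forward) recursions
    (hy0 : y 0 = yinit)
    (hY : ∀ k, 1 ≤ k → k ≤ K → ∀ i, Y k i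
      = y (k - 1) + Δt • ∑ j, a i j • Matrix.toEuclideanLin S (Y k j))
    (hd : ∀ k, 1 ≤ k → k ≤ K →
      d k = Δt • ∑ i, b i • Matrix.toEuclideanLin S (Y k i))
    (hdne : ∀ k, 1 ≤ k → k ≤ K → d k ≠ 0)
    (hγ : ∀ k, 1 ≤ k → k ≤ K → γ k = -2 * ⟪y (k - 1), d k⟫ / ‖d k‖ ^ 2)
    (hy : ∀ k, 1 ≤ k → k ≤ K → y k = y (k - 1) + γ k • d k)
    -- linearized IDT recursions (zero sources)
    (hδ0 : δ 0 = yinit)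
    (hΔ : ∀ k, 1 ≤ k → k ≤ K → ∀ i, Δ k i
      = δ (k - 1) + Δt • ∑ j, a i j • Matrix.toEuclideanLin S (Δ k j))
    (hρ : ∀ k, 1 ≤ k → k ≤ K → ρ k
      = ⟪(-(2 / ‖d k‖ ^ 2)) • d k, δ (k - 1)⟫
        + ∑ i, ⟪(-(2 * b i * Δt / ‖d k‖ ^ 2)) • Matrix.toEuclideanLin Sᵀ (y k), Δ k i⟫)
    (hδ : ∀ k, 1 ≤ k → k ≤ K → δ k
      = δ (k - 1) + (γ k * Δt) • ∑ i, b i • Matrix.toEuclideanLin S (Δ k i)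
        + ρ k • d k) :
    (∀ k, k ≤ K → δ k = y k) ∧
    (∀ k, 1 ≤ k → k ≤ K → ∀ i, Δ k i = Y k i) := by
  have stages : ∀ k, 1 ≤ k → k ≤ K → δ (k - 1) = y (k - 1) → ∀ i, Δ k i = Y k i := by
    intro k h1 hk hprev
    have hΔk := hΔ k h1 hk
    rw [hprev] at hΔk
    exact explicit_stages_unique _ ha Δt _ (hY k h1 hk) hΔk
  have main : ∀ k, k ≤ K → δ k = y k := by
    intro k
    induction k with
    | zero => exact fun _ => hδ0.trans hy0.symm
    | succ k ih =>
      intro hk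
      have h1 : 1 ≤ k + 1 := Nat.le_add_left 1 k
      have hprev : δ (k + 1 - 1) = y (k + 1 - 1) := ih (Nat.le_of_succ_le hk)
      have hst := stages (k + 1) h1 hk hprev
      have hyd : ∑ i, ⟪(-(2 * b i * Δt / ‖d (k + 1)‖ ^ 2)) •
            Matrix.toEuclideanLin Sᵀ (y (k + 1)), Δ (k + 1) i⟫
          = -(2 / ‖d (k + 1)‖ ^ 2) * ⟪y (k + 1), d (k + 1)⟫ := by
        conv_rhs => rw [hd (k + 1) h1 hk, real_inner_smul_right, inner_sum, Finset.mul_sum,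
          Finset.mul_sum, ← hd (k + 1) h1 hk]
        refine Finset.sum_congr rfl fun i _ => ?_
        rw [real_inner_smul_left, inner_toEuclideanLin_transpose_left, real_inner_smul_right,
          hst i]
        ring
      have hρ0 : ρ (k + 1) = 0 := by
        rw [hρ (k + 1) h1 hk, hyd, real_inner_smul_left, ← mul_add, hprev, hy (k + 1) h1 hk,
          hγ (k + 1) h1 hk, inner_add_inner_relaxed_eq_zero (hdne (k + 1) h1 hk), mul_zero]
      rw [hδ (k + 1) h1 hk, hρ0, zero_smul, add_zero, hprev, mul_smul,
        Finset.sum_congr rfl fun i _ => by rw [hst i], ← hd (k + 1) h1 hk, ← hy (k + 1) h1 hk]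
  exact ⟨main, fun k h1 hk => stages k h1 hk (main (k - 1) ((Nat.sub_le k 1).trans hk))⟩
end

section
/- (Time-symmetry of IDT on skew-symmetric linear systems.) Let S be a real N×N skew-symmetric matrix, let (a_{ij}) be a lower-triangular s×s matrix (a_{ij} = 0 for j > i; explicit or diagonally implicit Runge–Kutta) with weights b_1, …, b_s, let Δt > 0 and K ≥ 1. Suppose the IDT sequences satisfy: y_0 ∈ ℝ^N and for k = 1, …, K: Y_{k,i} = y_{k−1} + Δt Σ_{j=1}^{i} a_{ij} S Y_{k,j}, d_k = Δt Σ_i b_i S Y_{k,i} ≠ 0, γ_k = −2⟨y_{k−1}, d_k⟩/‖d_k‖², y_k = y_{k−1} + γ_k d_k. Suppose the adjoint IDT sequences with zero sources satisfy: λ_K = y_K, and for k = K, K−1, …, 1: ξ_k = Δt Σ_i b_i ⟨S Y_{k,i}, λ_k⟩, Λ_{k,i} = Δt Sᵀ (γ_k b_i λ_k + Σ_{j=1}^s a_{ji} Λ_{k,j}) + ξ_k (−(2 b_i Δt/‖d_k‖²) Sᵀ y_k), λ_{k−1} = λ_k + Σ_i Λ_{k,i} + ξ_k (−(2/‖d_k‖²)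 d_k). Then Λ_{k,i} = 0 for all k, i, and λ_k = y_k for all k = 0, …, K. -/
open scoped RealInnerProductSpace BigOperators
open Matrix

/-- A skew-symmetric matrix has a vanishing quadratic form. -/
lemma inner_toEuclideanLin_self_of_skew {n : Type*} [Fintype n] [DecidableEq n]
    {A : Matrix n n ℝ} (hA : Aᵀ = -A) (v : EuclideanSpace ℝ n) :
    ⟪Matrix.toEuclideanLin A v, v⟫ = 0 := by
  have hadj : ⟪Matrix.toEuclideanLin A v, v⟫ = ⟪v, Matrix.toEuclideanLin Aᵀ v⟫ := by
    rw [← Matrix.conjTranspose_eq_transpose_of_trivial,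
      Matrix.toEuclideanLin_conjTranspose_eq_adjoint, LinearMap.adjoint_inner_right]
  rw [hA, map_neg, LinearMap.neg_apply, inner_neg_right, real_inner_comm] at hadj
  rw [real_inner_comm]
  linarith

/-- A linear operator with vanishing quadratic form has no nonzero real eigenvalue. -/
lemma eq_zero_of_eq_smul_of_inner_self_eq_zero {E : Type*} [NormedAddCommGroup E]
    [InnerProductSpace ℝ E] {T : E →ₗ[ℝ] E} (hT : ∀ v, ⟪T v, v⟫ = 0) {c : ℝ} {v : E}
    (hv : v = c • T v) : v = 0 := by
  rw [← inner_self_eq_zero (𝕜 := ℝ)]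
  nth_rewrite 1 [hv]
  rw [real_inner_smul_left, hT, mul_zero]

/-- The homogeneous adjoint stage equations of a lower-triangular Runge–Kutta method for an
operator with vanishing quadratic form have only the trivial solution. -/
lemma adjoint_stages_eq_zero {E : Type*} [NormedAddCommGroup E] [InnerProductSpace ℝ E]
    {T : E →ₗ[ℝ] E} (hT : ∀ v, ⟪T v, v⟫ = 0) {ι : Type*} [Fintype ι] [LinearOrder ι]
    {a : ι → ι → ℝ} (ha : ∀ i j, i < j → a i j = 0) {c : ℝ} {L : ι → E}
    (hL : ∀ i, L i = c • T (∑ j, a j i • L j)) (i : ι) : L i = 0 := by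
  induction i using WellFoundedGT.induction with
  | ind i ih =>
    have hsum : ∑ j, a j i • L j = a i i • L i := by
      refine Finset.sum_eq_single i (fun j _ hj => ?_) (fun h => absurd (Finset.mem_univ i) h)
      rcases lt_or_gt_of_ne hj with h | h
      · rw [ha j i h, zero_smul]
      · rw [ih j h, smul_zero]
    refine eq_zero_of_eq_smul_of_inner_self_eq_zero hT (c := c * a i i) ?_
    rw [mul_smul, ← map_smul, ← hsum]
    exact hL i

/-- Relaxation by the nonzero root of the square entropy reflects the component along the
search direction, so `⟪d, y⟫` at the new point is half of `γ * ‖d‖ ^ 2`. -/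
lemma inner_relaxation_update {E : Type*} [NormedAddCommGroup E] [InnerProductSpace ℝ E]
    {x d : E} (hd : d ≠ 0) {g : ℝ} (hg : g = -2 * ⟪x, d⟫ / ‖d‖ ^ 2) :
    ⟪d, x + g • d⟫ = g * ‖d‖ ^ 2 / 2 := by
  have hn : ‖d‖ ^ 2 ≠ 0 := pow_ne_zero 2 (norm_ne_zero_iff.mpr hd)
  rw [inner_add_right, real_inner_smul_right, real_inner_self_eq_norm_sq,
    real_inner_comm, hg]
  field_simp
  ring

/-- (Time-symmetry of IDT on skew-symmetric linear systems.)
For a skew-symmetric matrix `S` and an explicit or diagonally implicit Runge–Kutta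
method (`a i j = 0` for `j > i`), if the IDT sequences `y, Y, d, γ` satisfy their
defining recursions with `d k ≠ 0`, and the adjoint IDT sequences `lam, Λ, ξ` (with
zero sources) satisfy their defining backward recursions with `lam K = y K`, then all
adjoint internal stages vanish, `Λ k i = 0`, and `lam k = y k` for all `k = 0, …, K`. -/
theorem idt_time_symmetry_skew (N s K : ℕ) (hK : 1 ≤ K)
    (S : Matrix (Fin N) (Fin N) ℝ) (hS : Sᵀ = -S)
    (a : Fin s → Fin s → ℝ) (ha : ∀ i j : Fin s, i < j → a i j = 0)
    (b : Fin s → ℝ) (Δt : ℝ) (hΔt : 0 < Δt)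
    (y lam : ℕ → EuclideanSpace ℝ (Fin N))
    (Y Λ : ℕ → Fin s → EuclideanSpace ℝ (Fin N))
    (d : ℕ → EuclideanSpace ℝ (Fin N)) (γ ξ : ℕ → ℝ)
    -- IDT (forward) recursions
    (hY : ∀ k, 1 ≤ k → k ≤ K → ∀ i, Y k i
      = y (k - 1) + Δt • ∑ j, a i j • Matrix.toEuclideanLin S (Y k j))
    (hd : ∀ k, 1 ≤ k → k ≤ K →
      d k = Δt • ∑ i, b i • Matrix.toEuclideanLin S (Y k i))
    (hdne : ∀ k, 1 ≤ k → k ≤ K → d k ≠ 0)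
    (hγ : ∀ k, 1 ≤ k → k ≤ K → γ k = -2 * ⟪y (k - 1), d k⟫ / ‖d k‖ ^ 2)
    (hy : ∀ k, 1 ≤ k → k ≤ K → y k = y (k - 1) + γ k • d k)
    -- adjoint IDT recursions (zero sources), marching backwards in time
    (hlamK : lam K = y K)
    (hξ : ∀ k, 1 ≤ k → k ≤ K →
      ξ k = Δt * ∑ i, b i * ⟪Matrix.toEuclideanLin S (Y k i), lam k⟫)
    (hΛ : ∀ k, 1 ≤ k → k ≤ K → ∀ i, Λ k i
      = Δt • Matrix.toEuclideanLin Sᵀ ((γ k * b i) • lam k + ∑ j, a j i • Λ k j)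
        + ξ k • ((-(2 * b i * Δt / ‖d k‖ ^ 2)) • Matrix.toEuclideanLin Sᵀ (y k)))
    (hlam : ∀ k, 1 ≤ k → k ≤ K → lam (k - 1)
      = lam k + ∑ i, Λ k i + ξ k • ((-(2 / ‖d k‖ ^ 2)) • d k)) :
    (∀ k, 1 ≤ k → k ≤ K → ∀ i, Λ k i = 0) ∧
    (∀ k, k ≤ K → lam k = y k) := by
  have step : ∀ k, 1 ≤ k → k ≤ K → lam k = y k →
      (∀ i, Λ k i = 0) ∧ lam (k - 1) = y (k - 1) := by
    intro k hk hkK hlk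
    have hn : ‖d k‖ ≠ 0 := norm_ne_zero_iff.mpr (hdne k hk hkK)
    have hξk : ξ k = γ k * ‖d k‖ ^ 2 / 2 := by
      rw [← inner_relaxation_update (hdne k hk hkK) (hγ k hk hkK), ← hy k hk hkK,
        hξ k hk hkK, hlk]
      rw [hd k hk hkK]
      simp only [real_inner_smul_left, sum_inner]
    have hskew : (Sᵀ)ᵀ = -Sᵀ := by rw [hS, Matrix.transpose_neg, hS]
    have hzero : ∀ i, Λ k i = 0 := by
      refine adjoint_stages_eq_zero (inner_toEuclideanLin_self_of_skew hskew) ha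
        (c := Δt) (fun i => ?_)
      have hcoef : ξ k * -(2 * b i * Δt / ‖d k‖ ^ 2) = -(Δt * (γ k * b i)) := by
        rw [hξk]
        field_simp
      rw [hΛ k hk hkK i, hlk, smul_smul (ξ k), hcoef, map_add, map_smul]
      module
    refine ⟨hzero, ?_⟩
    have hcoef : ξ k * -(2 / ‖d k‖ ^ 2) = -γ k := by
      rw [hξk]
      field_simp
    rw [hlam k hk hkK, smul_smul, hcoef, hlk, Finset.sum_eq_zero fun i _ => hzero i,
      hy k hk hkK]
    module
  have heq : ∀ k, k ≤ K → lam k = y k := by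
    intro k hk
    induction hk using Nat.decreasingInduction with
    | self => exact hlamK
    | of_succ k hk ih => exact (step (k + 1) (Nat.le_add_left 1 k) hk ih).2
  exact ⟨fun k hk hkK => (step k hk hkK (heq k hkK)).1, heq⟩
end

section
/- (Time-symmetry of RRK on skew-symmetric linear systems.) Let S be a real N×N skew-symmetric matrix, (a_{ij}) a lower-triangular s×s matrix (a_{ij} = 0 for j > i; explicit or diagonally implicit Runge–Kutta) with weights b_1, …, b_s, Δt > 0, Δt* > 0, K ≥ 2. Suppose the RRK sequences satisfy: y_0 ∈ ℝ^N; for k = 1, …, K−1: Y_{k,i} = y_{k−1} + Δt Σ_{j=1}^{i} a_{ij} S Y_{k,j}, d_k = Δt Σ_i b_i S Y_{k,i} ≠ 0, γ_k = −2⟨y_{k−1}, d_k⟩/‖d_k‖², y_k = y_{k−1} + γ_k d_k; for k = K the same with Δt replaced by Δt*. Suppose the adjoint RRK sequences with zero sources satisfy: λ_K = y_K; first adjoint step (k = K, step size Δt*): ξ_K = Δt* Σ_i b_i ⟨S Y_{K,i}, λ_K⟩, Λ_{K,i} = Δt* Sᵀ (γ_K b_i λ_K + Σ_j a_{ji} Λ_{K,j})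 + ξ_K (−(2 b_i Δt*/‖d_K‖²) Sᵀ y_K), λ_{K−1} = λ_K + Σ_i Λ_{K,i} + ξ_K (−(2/‖d_K‖²) d_K); ξ_* = Δt Σ_{i,j} a_{ji} ⟨S Y_{K,i}, Λ_{K,j}⟩; for k = K−1, …, 1: ξ_k = Δt Σ_i b_i ⟨S Y_{k,i}, λ_k⟩, Λ_{k,i} = Δt Sᵀ (γ_k b_i λ_k + Σ_j a_{ji} Λ_{k,j}) + (ξ_k − ξ_*)(−(2 b_i Δt/‖d_k‖²) Sᵀ y_k), λ_{k−1} = λ_k + Σ_i Λ_{k,i} + (ξ_k − ξ_*)(−(2/‖d_k‖²) d_k). Then ξ_* = 0, Λ_{k,i} = 0 for all k, i, and λ_k = y_k for all k = 0, …, K. -/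
open scoped RealInnerProductSpace BigOperators
open Matrix

/-- The quadratic form of a skew-symmetric matrix vanishes. -/
lemma inner_toEuclideanLin_self_of_transpose_eq_neg {N : ℕ} {S : Matrix (Fin N) (Fin N) ℝ}
    (hS : Sᵀ = -S) (v : EuclideanSpace ℝ (Fin N)) :
    ⟪Matrix.toEuclideanLin S v, v⟫ = 0 := by
  have hadj : ⟪Matrix.toEuclideanLin S v, v⟫ = ⟪v, Matrix.toEuclideanLin Sᵀ v⟫ := by
    rw [← Matrix.conjTranspose_eq_transpose_of_trivial,
      Matrix.toEuclideanLin_conjTranspose_eq_adjoint, LinearMap.adjoint_inner_right]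
  rw [hS, map_neg, LinearMap.neg_apply, inner_neg_right, real_inner_comm] at hadj
  rw [real_inner_comm]
  linarith

/-- The homogeneous adjoint stage equations of a lower-triangular Runge–Kutta method applied
to a skew-symmetric system have only the zero solution. -/
lemma adjoint_stages_eq_zero_s14 {N s : ℕ} {S : Matrix (Fin N) (Fin N) ℝ} (hS : Sᵀ = -S)
    {a : Fin s → Fin s → ℝ} (ha : ∀ i j : Fin s, i < j → a i j = 0) {h : ℝ}
    {Λ : Fin s → EuclideanSpace ℝ (Fin N)}
    (hΛ : ∀ i, Λ i = h • Matrix.toEuclideanLin Sᵀ (∑ j, a j i • Λ j)) (i : Fin s) :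
    Λ i = 0 := by
  induction i using WellFoundedGT.induction with
  | ind i ih =>
    have hsum : ∑ j, a j i • Λ j = a i i • Λ i := by
      refine Finset.sum_eq_single i (fun j _ hj => ?_) (by simp)
      rcases lt_or_gt_of_ne hj with hlt | hgt
      · rw [ha j i hlt, zero_smul]
      · rw [ih j hgt, smul_zero]
    have hi := hΛ i
    rw [hsum, map_smul] at hi
    have hT : Sᵀᵀ = -Sᵀ := by rw [hS, Matrix.transpose_neg, hS]
    rw [← inner_self_eq_zero (𝕜 := ℝ)]
    nth_rewrite 1 [hi]
    rw [inner_smul_left, inner_smul_left, inner_toEuclideanLin_self_of_transpose_eq_neg hT,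
      mul_zero, mul_zero]

/-- A relaxed adjoint step started from the forward solution has vanishing stages and
reproduces the previous forward value. -/
lemma adjoint_step_reverses {N s : ℕ} {S : Matrix (Fin N) (Fin N) ℝ} (hS : Sᵀ = -S)
    {a : Fin s → Fin s → ℝ} (ha : ∀ i j : Fin s, i < j → a i j = 0) {b : Fin s → ℝ}
    {h γ ξ : ℝ} {y₀ y₁ lam₀ d : EuclideanSpace ℝ (Fin N)}
    {Y Λ : Fin s → EuclideanSpace ℝ (Fin N)}
    (hd : d = h • ∑ i, b i • Matrix.toEuclideanLin S (Y i)) (hd0 : d ≠ 0)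
    (hγ : γ = -2 * ⟪y₀, d⟫ / ‖d‖ ^ 2) (hy : y₁ = y₀ + γ • d)
    (hξ : ξ = h * ∑ i, b i * ⟪Matrix.toEuclideanLin S (Y i), y₁⟫)
    (hΛ : ∀ i, Λ i
      = h • Matrix.toEuclideanLin Sᵀ ((γ * b i) • y₁ + ∑ j, a j i • Λ j)
        + ξ • ((-(2 * b i * h / ‖d‖ ^ 2)) • Matrix.toEuclideanLin Sᵀ y₁))
    (hlam : lam₀ = y₁ + ∑ i, Λ i + ξ • ((-(2 / ‖d‖ ^ 2)) • d)) :
    (∀ i, Λ i = 0) ∧ lam₀ = y₀ := by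
  have hn : ‖d‖ ^ 2 ≠ 0 := pow_ne_zero 2 (norm_ne_zero_iff.mpr hd0)
  have hξd : ξ = ⟪d, y₁⟫ := by
    rw [hξ, hd, real_inner_smul_left, sum_inner]
    simp_rw [real_inner_smul_left]
  have hγn : γ * ‖d‖ ^ 2 = -2 * ⟪y₀, d⟫ := by rw [hγ, div_mul_cancel₀ _ hn]
  have hξγ : ξ = γ * ‖d‖ ^ 2 / 2 := by
    rw [hξd, hy, inner_add_right, real_inner_smul_right, real_inner_self_eq_norm_sq,
      real_inner_comm]
    linarith
  have hzero : ∀ i, Λ i = 0 := by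
    refine adjoint_stages_eq_zero_s14 hS ha (h := h) fun i => ?_
    have hc : ξ * -(2 * b i * h / ‖d‖ ^ 2) = -(h * (γ * b i)) := by
      rw [hξγ]
      field_simp
    rw [hΛ i, map_add, map_smul, smul_smul, hc]
    module
  refine ⟨hzero, ?_⟩
  have hc : ξ * -(2 / ‖d‖ ^ 2) = -γ := by
    rw [hξγ]
    field_simp
  rw [hlam, smul_smul, hc, hy]
  simp [hzero]

/-- (Time-symmetry of RRK on skew-symmetric linear systems.)
For a skew-symmetric matrix `S` and an explicit or diagonally implicit Runge–Kutta
method (`a i j = 0` for `j > i`), with `K − 1` steps of size `Δt` and a final IDT step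
of corrected size `Δt*`, if the RRK sequences `y, Y, d, γ` (with `d k ≠ 0`) satisfy
their recursions and the adjoint RRK sequences `lam, Λ, ξ, ξ*` (with zero sources and
`lam K = y K`) satisfy their backward recursions, then `ξ* = 0`, all adjoint internal
stages vanish, and `lam k = y k` for all `k = 0, …, K`. -/
theorem rrk_time_symmetry_skew (N s K : ℕ) (hK : 2 ≤ K)
    (S : Matrix (Fin N) (Fin N) ℝ) (hS : Sᵀ = -S)
    (a : Fin s → Fin s → ℝ) (ha : ∀ i j : Fin s, i < j → a i j = 0)
    (b : Fin s → ℝ) (Δt Δts : ℝ) (hΔt : 0 < Δt) (hΔts : 0 < Δts)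
    (y lam : ℕ → EuclideanSpace ℝ (Fin N))
    (Y Λ : ℕ → Fin s → EuclideanSpace ℝ (Fin N))
    (d : ℕ → EuclideanSpace ℝ (Fin N)) (γ ξ : ℕ → ℝ) (ξstar : ℝ)
    -- RRK (forward) recursions: steps of size Δt for k = 1, …, K−1
    (hY : ∀ k, 1 ≤ k → k ≤ K - 1 → ∀ i, Y k i
      = y (k - 1) + Δt • ∑ j, a i j • Matrix.toEuclideanLin S (Y k j))
    (hd : ∀ k, 1 ≤ k → k ≤ K - 1 →
      d k = Δt • ∑ i, b i • Matrix.toEuclideanLin S (Y k i))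
    -- final forward step of size Δt*
    (hYK : ∀ i, Y K i
      = y (K - 1) + Δts • ∑ j, a i j • Matrix.toEuclideanLin S (Y K j))
    (hdK : d K = Δts • ∑ i, b i • Matrix.toEuclideanLin S (Y K i))
    (hdne : ∀ k, 1 ≤ k → k ≤ K → d k ≠ 0)
    (hγ : ∀ k, 1 ≤ k → k ≤ K → γ k = -2 * ⟪y (k - 1), d k⟫ / ‖d k‖ ^ 2)
    (hy : ∀ k, 1 ≤ k → k ≤ K → y k = y (k - 1) + γ k • d k)
    -- adjoint RRK recursions (zero sources), marching backwards in time
    (hlamK : lam K = y K)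
    -- first adjoint step (k = K, step size Δt*)
    (hξK : ξ K = Δts * ∑ i, b i * ⟪Matrix.toEuclideanLin S (Y K i), lam K⟫)
    (hΛK : ∀ i, Λ K i
      = Δts • Matrix.toEuclideanLin Sᵀ ((γ K * b i) • lam K + ∑ j, a j i • Λ K j)
        + ξ K • ((-(2 * b i * Δts / ‖d K‖ ^ 2)) • Matrix.toEuclideanLin Sᵀ (y K)))
    (hlamKm1 : lam (K - 1)
      = lam K + ∑ i, Λ K i + ξ K • ((-(2 / ‖d K‖ ^ 2)) • d K))
    (hξstar : ξstar
      = Δt * ∑ i, ∑ j, a j i * ⟪Matrix.toEuclideanLin S (Y K i), Λ K j⟫)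
    -- remaining adjoint steps k = K−1, …, 1
    (hξ : ∀ k, 1 ≤ k → k ≤ K - 1 →
      ξ k = Δt * ∑ i, b i * ⟪Matrix.toEuclideanLin S (Y k i), lam k⟫)
    (hΛ : ∀ k, 1 ≤ k → k ≤ K - 1 → ∀ i, Λ k i
      = Δt • Matrix.toEuclideanLin Sᵀ ((γ k * b i) • lam k + ∑ j, a j i • Λ k j)
        + (ξ k - ξstar) • ((-(2 * b i * Δt / ‖d k‖ ^ 2)) • Matrix.toEuclideanLin Sᵀ (y k)))
    (hlam : ∀ k, 1 ≤ k → k ≤ K - 1 → lam (k - 1)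
      = lam k + ∑ i, Λ k i + (ξ k - ξstar) • ((-(2 / ‖d k‖ ^ 2)) • d k)) :
    ξstar = 0 ∧
    (∀ k, 1 ≤ k → k ≤ K → ∀ i, Λ k i = 0) ∧
    (∀ k, k ≤ K → lam k = y k) := by
  obtain ⟨hΛK0, hlamK0⟩ := adjoint_step_reverses hS ha hdK (hdne K (by omega) le_rfl)
    (hγ K (by omega) le_rfl) (hy K (by omega) le_rfl) (hlamK ▸ hξK) (hlamK ▸ hΛK)
    (hlamK ▸ hlamKm1)
  have hstar : ξstar = 0 := by simp [hξstar, hΛK0]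
  have step : ∀ k, 1 ≤ k → k ≤ K - 1 → lam k = y k →
      (∀ i, Λ k i = 0) ∧ lam (k - 1) = y (k - 1) := by
    intro k h1 hk heq
    have hξk := hξ k h1 hk
    have hΛk := hΛ k h1 hk
    have hlamk := hlam k h1 hk
    rw [heq] at hξk hlamk
    simp only [heq, hstar, sub_zero] at hΛk hlamk
    exact adjoint_step_reverses hS ha (hd k h1 hk) (hdne k h1 (by omega))
      (hγ k h1 (by omega)) (hy k h1 (by omega)) hξk hΛk hlamk
  have hback : ∀ k, k ≤ K - 1 → lam k = y k := fun k hk =>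
    Nat.decreasingInduction' (P := fun k => lam k = y k)
      (fun j hj _ ih => (step (j + 1) (by omega) (by omega) ih).2) hk hlamK0
  refine ⟨hstar, fun k h1 hk => ?_, fun k hk => ?_⟩
  · rcases hk.eq_or_lt with rfl | hlt
    · exact hΛK0
    · exact (step k h1 (by omega) (hback k (by omega))).1
  · rcases hk.eq_or_lt with rfl | hlt
    · exact hlamK
    · exact hback k (by omega)
end

section
/- (The discrete adjoint of an explicit IDT/relaxation Runge–Kutta step is the transpose of its linearization.) Let J_1, …, J_s be real N×N matrices, F_1, …, F_s, g_y, g_{Y,1}, …, g_{Y,s} ∈ ℝ^N, (a_{ij}) with a_{ij} = 0 for j ≥ i and b_1, …, b_s real Runge–Kutta coefficients, and γ, Δt ∈ ℝ. For δ ∈ ℝ^N define the linearized IDT step T(δ) := δ + γ Δt Σ_{i=1}^s b_i J_i Δ_i + ρ Δt Σ_{i=1}^s b_i F_i, where Δ_i = δ + Δt Σ_{j<i} a_{ij} J_j Δ_j and ρ = ⟨g_y, δ⟩ + Σ_{i=1}^s ⟨g_{Y,i}, Δ_i⟩. For λ ∈ ℝ^N define the adjoint IDT step T*(λ) := λ +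 Σ_{i=1}^s Λ_i + ξ g_y, where ξ = Δt Σ_{i=1}^s b_i ⟨F_i, λ⟩ and Λ_i = Δt J_iᵀ (γ b_i λ + Σ_{j>i} a_{ji} Λ_j) + ξ g_{Y,i}. Then ⟨T(δ), λ⟩ = ⟨δ, T*(λ)⟩ for all δ, λ ∈ ℝ^N. -/
open scoped RealInnerProductSpace BigOperators
open Matrix

/-- The transpose of a real matrix is its adjoint for the Euclidean inner product. -/
theorem Matrix.inner_toEuclideanLin_transpose_right {m n : Type*} [Fintype m] [Fintype n]
    [DecidableEq m] [DecidableEq n] (A : Matrix m n ℝ)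
    (x : EuclideanSpace ℝ n) (y : EuclideanSpace ℝ m) :
    ⟪x, Matrix.toEuclideanLin Aᵀ y⟫ = ⟪Matrix.toEuclideanLin A x, y⟫ := by
  rw [← Matrix.conjTranspose_eq_transpose_of_trivial,
    Matrix.toEuclideanLin_conjTranspose_eq_adjoint, LinearMap.adjoint_inner_right]

/-- (The discrete adjoint of an explicit IDT/relaxation Runge–Kutta step
is the transpose of its linearization.) For stage Jacobians `J i`, stage values `F i`,
relaxation-parameter gradients `g_y`, `g_{Y,i}`, explicit coefficients
(`a i j = 0` for `j ≥ i`) and weights `b`, if `Δ, ρ` solve the linearized IDT stage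
equations for `δ` and `Λ, ξ` solve the adjoint IDT stage equations for `λ`, then
`⟨T(δ), λ⟩ = ⟨δ, T*(λ)⟩` where
`T(δ) = δ + γ Δt ∑ᵢ bᵢ Jᵢ Δᵢ + ρ Δt ∑ᵢ bᵢ Fᵢ` and `T*(λ) = λ + ∑ᵢ Λᵢ + ξ g_y`. -/
theorem idt_adjoint_step_is_transpose (N s : ℕ)
    (J : Fin s → Matrix (Fin N) (Fin N) ℝ)
    (F : Fin s → EuclideanSpace ℝ (Fin N))
    (gy : EuclideanSpace ℝ (Fin N)) (gY : Fin s → EuclideanSpace ℝ (Fin N))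
    (a : Fin s → Fin s → ℝ) (ha : ∀ i j : Fin s, i ≤ j → a i j = 0)
    (b : Fin s → ℝ) (γ Δt : ℝ)
    (δ lam : EuclideanSpace ℝ (Fin N))
    (Δ Λ : Fin s → EuclideanSpace ℝ (Fin N)) (ρ ξ : ℝ)
    (hΔ : ∀ i, Δ i = δ + Δt • ∑ j, a i j • Matrix.toEuclideanLin (J j) (Δ j))
    (hρ : ρ = ⟪gy, δ⟫ + ∑ i, ⟪gY i, Δ i⟫)
    (hξ : ξ = Δt * ∑ i, b i * ⟪F i, lam⟫)
    (hΛ : ∀ i, Λ i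
      = Δt • Matrix.toEuclideanLin (J i)ᵀ ((γ * b i) • lam + ∑ j, a j i • Λ j)
        + ξ • gY i) :
    ⟪δ + (γ * Δt) • ∑ i, b i • Matrix.toEuclideanLin (J i) (Δ i)
        + (ρ * Δt) • ∑ i, b i • F i, lam⟫
      = ⟪δ, lam + ∑ i, Λ i + ξ • gy⟫ := by
  have forward (i : Fin s) : ⟪Δ i, Λ i⟫
      = ⟪δ, Λ i⟫ + Δt * ∑ j, a i j * ⟪Matrix.toEuclideanLin (J j) (Δ j), Λ i⟫ := by
    conv_lhs => rw [hΔ i]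
    simp only [inner_add_left, real_inner_smul_left, sum_inner]
  have backward (i : Fin s) : ⟪Δ i, Λ i⟫
      = γ * Δt * (b i * ⟪Matrix.toEuclideanLin (J i) (Δ i), lam⟫)
        + Δt * ∑ j, a j i * ⟪Matrix.toEuclideanLin (J i) (Δ i), Λ j⟫
        + ξ * ⟪gY i, Δ i⟫ := by
    conv_lhs => rw [hΛ i]
    simp only [inner_add_right, real_inner_smul_right,
      Matrix.inner_toEuclideanLin_transpose_right, inner_sum, real_inner_comm (Δ i) (gY i)]
    ring
  have sum_inner_stages : ∑ i, ⟪δ, Λ i⟫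
      = γ * Δt * ∑ i, b i * ⟪Matrix.toEuclideanLin (J i) (Δ i), lam⟫
        + ξ * ∑ i, ⟪gY i, Δ i⟫ := by
    have h := Finset.sum_congr rfl fun i (_ : i ∈ Finset.univ) =>
      (forward i).symm.trans (backward i)
    simp only [Finset.sum_add_distrib, ← Finset.mul_sum] at h
    rw [Finset.sum_comm (f := fun i j => a i j * ⟪Matrix.toEuclideanLin (J j) (Δ j), Λ i⟫)] at h
    linarith
  simp only [inner_add_left, inner_add_right, real_inner_smul_left, real_inner_smul_right,
    sum_inner, inner_sum, sum_inner_stages, real_inner_comm gy δ]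
  rw [mul_assoc ρ, ← hξ, hρ]
  ring
end

section
/- (The K-step discrete adjoint of the linearized RRK method is its transpose.) Fix K ≥ 2, real N×N matrices J_{k,i}, vectors F_{k,i}, g_{y,k}, g_{Y,k,i} ∈ ℝ^N (k = 1, …, K; i = 1, …, s), scalars γ_1, …, γ_K ∈ ℝ, step sizes Δt, Δt* ∈ ℝ, and explicit Runge–Kutta coefficients (a_{ij}) with a_{ij} = 0 for j ≥ i and weights b_1, …, b_s. Given δ_0 ∈ ℝ^N, define the linearized RRK sequences: for k = 1, …, K−1: Δ_{k,i} = δ_{k−1} + Δt Σ_{j<i} a_{ij} J_{k,j} Δ_{k,j}, ρ_k = ⟨g_{y,k}, δ_{k−1}⟩ + Σ_i ⟨g_{Y,k,i}, Δ_{k,i}⟩, δ_k = δ_{k−1} + γ_k Δt Σ_i b_i J_{k,i} Δ_{k,i} + ρ_k Δt Σ_i b_i F_{k,i}; ρ_* = Σ_{k=1}^{K−1} ρ_k; final step: Δ_{K,i} = δ_{K−1} + Δt* Σ_{j<i} a_{ij} J_{K,j} Δ_{K,j} − ρ_* Δt Σ_{j<i} a_{ij} F_{K,j}, ρ_K = ⟨g_{y,K},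 δ_{K−1}⟩ + Σ_i ⟨g_{Y,K,i}, Δ_{K,i}⟩, δ_K = δ_{K−1} + γ_K Δt* Σ_i b_i J_{K,i} Δ_{K,i} + ρ_K Δt* Σ_i b_i F_{K,i}. Given λ_K ∈ ℝ^N, define the adjoint RRK sequences: ξ_K = Δt* Σ_i b_i ⟨F_{K,i}, λ_K⟩, Λ_{K,i} = Δt* J_{K,i}ᵀ (γ_K b_i λ_K + Σ_{j>i} a_{ji} Λ_{K,j}) + ξ_K g_{Y,K,i}, λ_{K−1} = λ_K + Σ_i Λ_{K,i} + ξ_K g_{y,K}; ξ_* = Δt Σ_i Σ_j a_{ji} ⟨F_{K,i}, Λ_{K,j}⟩; for k = K−1, …, 1: ξ_k = Δt Σ_i b_i ⟨F_{k,i}, λ_k⟩, Λ_{k,i} = Δt J_{k,i}ᵀ (γ_k b_i λ_k + Σ_{j>i} a_{ji} Λ_{k,j}) + (ξ_k − ξ_*) g_{Y,k,i}, λ_{k−1} = λ_k + Σ_i Λ_{k,i} + (ξ_k − ξ_*) g_{y,k}. Then ⟨δ_K, λ_K⟩ = ⟨δ_0, λ_0⟩ for all δ_0, λ_K ∈ ℝ^N.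 -/
open scoped RealInnerProductSpace BigOperators
open Matrix

/-- The matrix transpose is the adjoint for the Euclidean inner product. -/
theorem inner_toEuclideanLin_left {m n : Type*} [Fintype m] [DecidableEq m] [Fintype n]
    [DecidableEq n] (M : Matrix m n ℝ) (x : EuclideanSpace ℝ n) (y : EuclideanSpace ℝ m) :
    ⟪Matrix.toEuclideanLin M x, y⟫ = ⟪x, Matrix.toEuclideanLin Mᵀ y⟫ := by
  rw [← Matrix.conjTranspose_eq_transpose_of_trivial,
    Matrix.toEuclideanLin_conjTranspose_eq_adjoint, LinearMap.adjoint_inner_right]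

/-- Duality identity for one step of a linearized relaxation Runge–Kutta method and of its adjoint,
with stage shift `σ` in the linearized step and scalar shift `c` in the adjoint step. -/
theorem rrk_step_duality {ι E : Type*} [Fintype ι] [NormedAddCommGroup E] [InnerProductSpace ℝ E]
    (A A' : ι → E → E) (hA : ∀ i x y, ⟪A i x, y⟫ = ⟪x, A' i y⟫)
    (F gY Δ Λ : ι → E) (gy d₀ d₁ l₀ l₁ : E) (γ h σ c ρ ξ : ℝ) (a : ι → ι → ℝ) (b : ι → ℝ)
    (hΔ : ∀ i, Δ i = d₀ + h • ∑ j, a i j • A j (Δ j) - σ • ∑ j, a i j • F j)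
    (hρ : ρ = ⟪gy, d₀⟫ + ∑ i, ⟪gY i, Δ i⟫)
    (hd : d₁ = d₀ + (γ * h) • ∑ i, b i • A i (Δ i) + (ρ * h) • ∑ i, b i • F i)
    (hξ : ξ = h * ∑ i, b i * ⟪F i, l₁⟫)
    (hΛ : ∀ i, Λ i = h • A' i ((γ * b i) • l₁ + ∑ j, a j i • Λ j) + (ξ - c) • gY i)
    (hl : l₀ = l₁ + ∑ i, Λ i + (ξ - c) • gy) :
    ⟪d₁, l₁⟫ = ⟪d₀, l₀⟫ - σ * (∑ i, ∑ j, a j i * ⟪F i, Λ j⟫) + c * ρ := by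
  have hforward : ∑ i, ⟪Δ i, Λ i⟫ = ∑ i, ⟪d₀, Λ i⟫
      + h * (∑ i, ∑ j, a j i * ⟪A i (Δ i), Λ j⟫) - σ * ∑ i, ∑ j, a j i * ⟪F i, Λ j⟫ := by
    have hi (i : ι) : ⟪Δ i, Λ i⟫ = ⟪d₀, Λ i⟫ + h * (∑ j, a i j * ⟪A j (Δ j), Λ i⟫)
        - σ * ∑ j, a i j * ⟪F j, Λ i⟫ := by
      conv_lhs => rw [hΔ i]
      simp only [inner_sub_left, inner_add_left, real_inner_smul_left, sum_inner]
    rw [Finset.sum_congr rfl fun i _ => hi i, Finset.sum_sub_distrib, Finset.sum_add_distrib,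
      ← Finset.mul_sum, ← Finset.mul_sum, Finset.sum_comm,
      Finset.sum_comm (f := fun i j => a i j * ⟪F j, Λ i⟫)]
  have hbackward : ∑ i, ⟪Δ i, Λ i⟫ = γ * h * (∑ i, b i * ⟪A i (Δ i), l₁⟫)
      + h * (∑ i, ∑ j, a j i * ⟪A i (Δ i), Λ j⟫) + (ξ - c) * ∑ i, ⟪gY i, Δ i⟫ := by
    have hi (i : ι) : ⟪Δ i, Λ i⟫ = γ * h * (b i * ⟪A i (Δ i), l₁⟫)
        + h * (∑ j, a j i * ⟪A i (Δ i), Λ j⟫) + (ξ - c) * ⟪gY i, Δ i⟫ := by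
      conv_lhs => rw [hΛ i]
      rw [inner_add_right, real_inner_smul_right, ← hA, inner_add_right, inner_sum]
      simp only [real_inner_smul_right, real_inner_comm (gY i) (Δ i)]
      ring
    rw [Finset.sum_congr rfl fun i _ => hi i, Finset.sum_add_distrib, Finset.sum_add_distrib,
      ← Finset.mul_sum, ← Finset.mul_sum, ← Finset.mul_sum]
  have hd₁ : ⟪d₁, l₁⟫ = ⟪d₀, l₁⟫ + γ * h * (∑ i, b i * ⟪A i (Δ i), l₁⟫) + ρ * ξ := by
    rw [hd, hξ]
    simp only [inner_add_left, real_inner_smul_left, sum_inner]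
    ring
  have hl₀ : ⟪d₀, l₀⟫ = ⟪d₀, l₁⟫ + ∑ i, ⟪d₀, Λ i⟫ + (ξ - c) * ⟪gy, d₀⟫ := by
    rw [hl, inner_add_right, inner_add_right, inner_sum, real_inner_smul_right,
      real_inner_comm d₀ gy]
  linear_combination hd₁ - hl₀ - hbackward + hforward + (ξ - c) * hρ

/-- (The K-step discrete adjoint of the linearized RRK method is its
transpose.) For stage Jacobians `J k i`, stage values `F k i`, relaxation-parameter
gradients `gy k`, `gY k i`, relaxation parameters `γ k`, explicit coefficients
(`a i j = 0` for `j ≥ i`) with weights `b`, step sizes `Δt, Δt*`: if the linearized RRK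
sequences `δ, Δ, ρ, ρ*` (started from `δ 0`) and the adjoint RRK sequences
`lam, Λ, ξ, ξ*` (started from `lam K`) satisfy their defining recursions, then
`⟨δ K, lam K⟩ = ⟨δ 0, lam 0⟩`. -/
theorem rrk_K_step_adjoint_is_transpose (N s K : ℕ) (hK : 2 ≤ K)
    (J : ℕ → Fin s → Matrix (Fin N) (Fin N) ℝ)
    (F : ℕ → Fin s → EuclideanSpace ℝ (Fin N))
    (gy : ℕ → EuclideanSpace ℝ (Fin N))
    (gY : ℕ → Fin s → EuclideanSpace ℝ (Fin N))
    (γ : ℕ → ℝ) (Δt Δts : ℝ)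
    (a : Fin s → Fin s → ℝ) (ha : ∀ i j : Fin s, i ≤ j → a i j = 0)
    (b : Fin s → ℝ)
    (δ lam : ℕ → EuclideanSpace ℝ (Fin N))
    (Δ Λ : ℕ → Fin s → EuclideanSpace ℝ (Fin N))
    (ρ ξ : ℕ → ℝ) (ρstar ξstar : ℝ)
    -- linearized RRK recursions: steps k = 1, …, K−1
    (hΔ : ∀ k, 1 ≤ k → k ≤ K - 1 → ∀ i, Δ k i
      = δ (k - 1) + Δt • ∑ j, a i j • Matrix.toEuclideanLin (J k j) (Δ k j))
    (hρ : ∀ k, 1 ≤ k → k ≤ K - 1 →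
      ρ k = ⟪gy k, δ (k - 1)⟫ + ∑ i, ⟪gY k i, Δ k i⟫)
    (hδ : ∀ k, 1 ≤ k → k ≤ K - 1 → δ k
      = δ (k - 1) + (γ k * Δt) • ∑ i, b i • Matrix.toEuclideanLin (J k i) (Δ k i)
        + (ρ k * Δt) • ∑ i, b i • F k i)
    (hρstar : ρstar = ∑ k ∈ Finset.Icc 1 (K - 1), ρ k)
    -- final linearized step of size Δt*
    (hΔK : ∀ i, Δ K i
      = δ (K - 1) + Δts • ∑ j, a i j • Matrix.toEuclideanLin (J K j) (Δ K j)
        - (ρstar * Δt) • ∑ j, a i j • F K j)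
    (hρK : ρ K = ⟪gy K, δ (K - 1)⟫ + ∑ i, ⟪gY K i, Δ K i⟫)
    (hδK : δ K
      = δ (K - 1) + (γ K * Δts) • ∑ i, b i • Matrix.toEuclideanLin (J K i) (Δ K i)
        + (ρ K * Δts) • ∑ i, b i • F K i)
    -- adjoint RRK recursions: first adjoint step (k = K, step size Δt*)
    (hξK : ξ K = Δts * ∑ i, b i * ⟪F K i, lam K⟫)
    (hΛK : ∀ i, Λ K i
      = Δts • Matrix.toEuclideanLin (J K i)ᵀ ((γ K * b i) • lam K + ∑ j, a j i • Λ K j)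
        + ξ K • gY K i)
    (hlamKm1 : lam (K - 1) = lam K + ∑ i, Λ K i + ξ K • gy K)
    (hξstar : ξstar = Δt * ∑ i, ∑ j, a j i * ⟪F K i, Λ K j⟫)
    -- remaining adjoint steps k = K−1, …, 1
    (hξ : ∀ k, 1 ≤ k → k ≤ K - 1 → ξ k = Δt * ∑ i, b i * ⟪F k i, lam k⟫)
    (hΛ : ∀ k, 1 ≤ k → k ≤ K - 1 → ∀ i, Λ k i
      = Δt • Matrix.toEuclideanLin (J k i)ᵀ ((γ k * b i) • lam k + ∑ j, a j i • Λ k j)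
        + (ξ k - ξstar) • gY k i)
    (hlam : ∀ k, 1 ≤ k → k ≤ K - 1 → lam (k - 1)
      = lam k + ∑ i, Λ k i + (ξ k - ξstar) • gy k) :
    ⟪δ K, lam K⟫ = ⟪δ 0, lam 0⟫ := by
  have hstep (k : ℕ) (hk : k ≤ K - 1) :
      ⟪δ k, lam k⟫ = ⟪δ 0, lam 0⟫ + ξstar * ∑ m ∈ Finset.Icc 1 k, ρ m := by
    induction k with
    | zero => simp
    | succ k ih =>
      have hk₁ : 1 ≤ k + 1 := Nat.le_add_left 1 k
      have h := rrk_step_duality (fun i => Matrix.toEuclideanLin (J (k + 1) i))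
        (fun i => Matrix.toEuclideanLin (J (k + 1) i)ᵀ)
        (fun i => inner_toEuclideanLin_left (J (k + 1) i))
        (F (k + 1)) (gY (k + 1)) (Δ (k + 1)) (Λ (k + 1)) (gy (k + 1)) (δ k) (δ (k + 1))
        (lam k) (lam (k + 1)) (γ (k + 1)) Δt 0 ξstar (ρ (k + 1)) (ξ (k + 1)) a b
        (by simpa using hΔ (k + 1) hk₁ hk) (hρ (k + 1) hk₁ hk) (hδ (k + 1) hk₁ hk)
        (hξ (k + 1) hk₁ hk) (hΛ (k + 1) hk₁ hk) (hlam (k + 1) hk₁ hk)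
      rw [h, ih (Nat.le_of_succ_le hk), Finset.sum_Icc_succ_top hk₁]
      ring
  have hfinal := rrk_step_duality (fun i => Matrix.toEuclideanLin (J K i))
    (fun i => Matrix.toEuclideanLin (J K i)ᵀ) (fun i => inner_toEuclideanLin_left (J K i))
    (F K) (gY K) (Δ K) (Λ K) (gy K) (δ (K - 1)) (δ K) (lam (K - 1)) (lam K) (γ K) Δts
    (ρstar * Δt) 0 (ρ K) (ξ K) a b hΔK hρK hδK hξK (by simpa using hΛK) (by simpa using hlamKm1)
  rw [hfinal, hstep (K - 1) le_rfl, ← hρstar, hξstar]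
  ring
end
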